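/- Let θ be the substitution sending x to A ∧ x and fixing all other atoms. Then: (1) x is positive in θ(A); (2) if an atom y is positive in A, then y is positive in θ(A). (Classical semantics.) -/

import Mathlib

inductive Form (var par : Type) : Type where
  | bot : Form var par
  | v : var → Form var par
  | p : par → Form var par
  | and : Form var par → Form var par → Form var par
  | or : Form var par → Form var par → Form var par
  | imp : Form var par → Form var par → Form var par

namespace Form
variable {var par : Type}

def neg (A : Form var par) : Form var par := A.imp .bot
def top : Form var par := Form.neg .bot
def fiff (A B : Form var par) : Form var par := (A.imp B).and (B.imp A)

/-- `varFree A`: `A` contains no variables (it lies in the parameter-only sublanguage). -/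
def varFree : Form var par → Prop
  | .bot => True
  | .v _ => False
  | .p _ => True
  | .and A B => varFree A ∧ varFree B
  | .or A B => varFree A ∧ varFree B
  | .imp A B => varFree A ∧ varFree B

/-- Substitutions act on variables, fix parameters, and commute with connectives. -/
def subst (θ : var → Form var par) : Form var par → Form var par
  | .bot => .bot
  | .v x => θ x
  | .p q => .p q
  | .and A B => (subst θ A).and (subst θ B)
  | .or A B => (subst θ A).or (subst θ B)
  | .imp A B => (subst θ A).imp (subst θ B)

end Form

/-- Hilbert-style provability: `cl = false` is intuitionistic logic (IPC),
`cl = true` is classical logic (CPC). -/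
inductive Prv {var par : Type} (cl : Bool) : Form var par → Prop where
  | mp {A B : Form var par} : Prv cl (A.imp B) → Prv cl A → Prv cl B
  | k {A B : Form var par} : Prv cl (A.imp (B.imp A))
  | s {A B C : Form var par} :
      Prv cl ((A.imp (B.imp C)).imp ((A.imp B).imp (A.imp C)))
  | andI {A B : Form var par} : Prv cl (A.imp (B.imp (A.and B)))
  | andE1 {A B : Form var par} : Prv cl ((A.and B).imp A)
  | andE2 {A B : Form var par} : Prv cl ((A.and B).imp B)
  | orI1 {A B : Form var par} : Prv cl (A.imp (A.or B))
  | orI2 {A B : Form var par} : Prv cl (B.imp (A.or B))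
  | orE {A B C : Form var par} :
      Prv cl ((A.imp C).imp ((B.imp C).imp ((A.or B).imp C)))
  | exf {A : Form var par} : Prv cl (Form.bot.imp A)
  | dne {A : Form var par} : cl = true → Prv cl (A.neg.neg.imp A)

/-- `U` is the uniform post-interpolant of `A` with respect to the parameters. -/
def IsUPI {var par : Type} (cl : Bool) (A U : Form var par) : Prop :=
  U.varFree ∧ Prv cl (A.imp U) ∧
    ∀ C : Form var par, C.varFree → Prv cl (A.imp C) → Prv cl (U.imp C)

/-- Boolean evaluation of a formula under a valuation of the atoms. -/
def evalF {var par : Type} (I : var ⊕ par → Bool) : Form var par → Bool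
  | .bot => false
  | .v x => I (.inl x)
  | .p q => I (.inr q)
  | .and A B => evalF I A && evalF I B
  | .or A B => evalF I A || evalF I B
  | .imp A B => !evalF I A || evalF I B

def atomF {var par : Type} : var ⊕ par → Form var par
  | .inl x => .v x
  | .inr q => .p q

/-- Syntactic replacement of the atom `a` by the formula `C`. -/
def replaceAtom {var par : Type} [DecidableEq var] [DecidableEq par]
    (a : var ⊕ par) (C : Form var par) : Form var par → Form var par
  | .bot => .bot
  | .v x => if (Sum.inl x : var ⊕ par) = a then C else .v x
  | .p q => if (Sum.inr q : var ⊕ par) = a then C else .p q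
  | .and A B => (replaceAtom a C A).and (replaceAtom a C B)
  | .or A B => (replaceAtom a C A).or (replaceAtom a C B)
  | .imp A B => (replaceAtom a C A).imp (replaceAtom a C B)

/-- The atom `a` is positive in `A`. -/
def PositiveIn {var par : Type} (a : var ⊕ par) (A : Form var par) : Prop :=
  ∀ I J : var ⊕ par → Bool, I a ≤ J a → (∀ b, b ≠ a → I b = J b) →
    evalF I A ≤ evalF J A

/-- Classical (semantic) validity: a tautology. -/
def Valid {var par : Type} (A : Form var par) : Prop :=
  ∀ I : var ⊕ par → Bool, evalF I A = true

theorem evalF_replaceAtom_aux {var par : Type} [DecidableEq var] [DecidableEq par]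
    (x : var ⊕ par) (C : Form var par) (I : var ⊕ par → Bool) (B : Form var par) :
    evalF I (replaceAtom x C B) = evalF (Function.update I x (evalF I C)) B := by
  induction B with
  | bot => rfl
  | v z =>
    by_cases h : (Sum.inl z : var ⊕ par) = x
    · subst h; simp [replaceAtom, evalF]
    · simp [replaceAtom, evalF, h, Function.update_of_ne h]
  | p z =>
    by_cases h : (Sum.inr z : var ⊕ par) = x
    · subst h; simp [replaceAtom, evalF]
    · simp [replaceAtom, evalF, h, Function.update_of_ne h]
  | and A B ihA ihB => simp [replaceAtom, evalF, ihA, ihB]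
  | or A B ihA ihB => simp [replaceAtom, evalF, ihA, ihB]
  | imp A B ihA ihB => simp [replaceAtom, evalF, ihA, ihB]

theorem evalF_theta_aux {var par : Type} [DecidableEq var] [DecidableEq par]
    (x : var ⊕ par) (A : Form var par) (I : var ⊕ par → Bool) :
    evalF I (replaceAtom x (A.and (atomF x)) A) =
      (evalF (Function.update I x false) A ||
        (I x && evalF (Function.update I x true) A)) := by
  have hx : evalF I (atomF x) = I x := by cases x <;> rfl
  have hI : Function.update I x (I x) = I := Function.update_eq_self x I
  rw [evalF_replaceAtom_aux]
  simp only [evalF, hx]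
  cases h : I x
  · simp
  · rw [h] at hI
    rw [hI]
    cases h2 : evalF I A
    · simp
    · simp [hI, h2]

theorem theta_pos_self_aux {var par : Type} [DecidableEq var] [DecidableEq par]
    (x : var ⊕ par) (A : Form var par) :
    PositiveIn x (replaceAtom x (A.and (atomF x)) A) := by
  intro I J h hIJ
  have e : ∀ c, Function.update I x c = Function.update J x c := by
    intro c
    funext b
    by_cases hb : b = x
    · subst hb; simp
    · simp [Function.update_of_ne hb, hIJ b hb]
  rw [evalF_theta_aux, evalF_theta_aux, e, e]
  revert h
  generalize I x = a
  generalize J x = b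
  generalize evalF _ A = c
  generalize evalF _ A = d
  revert a b c d
  decide

/-- With `θ` replacing the atom `x` by `A ∧ x`: `x` is positive in `θ(A)`, and any
atom positive in `A` remains positive in `θ(A)`. -/
theorem theta_makes_positive {var par : Type} [DecidableEq var] [DecidableEq par]
    (x : var ⊕ par) (A : Form var par) :
    PositiveIn x (replaceAtom x (A.and (atomF x)) A) ∧
      ∀ y : var ⊕ par, PositiveIn y A →
        PositiveIn y (replaceAtom x (A.and (atomF x)) A) := by 
  refine ⟨theta_pos_self_aux x A, fun y hy => ?_⟩
  by_cases hyx : y = x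
  · subst hyx; exact theta_pos_self_aux y A
  intro I J h hIJ
  have e : ∀ c, evalF (Function.update I x c) A ≤ evalF (Function.update J x c) A := by
    intro c
    apply hy
    · simpa [Function.update_of_ne hyx] using h
    · intro b hb
      by_cases hbx : b = x
      · subst hbx; simp
      · simp [Function.update_of_ne hbx, hIJ b hb]
  have e0 := e false
  have e1 := e true
  rw [evalF_theta_aux, evalF_theta_aux, hIJ x (Ne.symm hyx)]
  revert e0 e1
  generalize J x = a
  generalize evalF (Function.update I x false) A = b
  generalize evalF (Function.update I x true) A = c
  generalize evalF (Function.update J x false) A = d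
  generalize evalF (Function.update J x true) A = f
  clear e
  revert a b c d f
  decide
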